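/- arXiv:2108.13361 — 9 statements merged into one kernel-verified Lean document; each statement's English description precedes it below -/
import Mathlib

section
/- Let n ∈ ℕ and let f : ℝⁿ → ℝⁿ be C^∞. Let u⁺ : ℝ → ℝⁿ be C^∞ on [0,∞) and satisfy the one-sided ODE derivWithin u⁺ [0,∞) x = f(u⁺(x)) for all x ≥ 0; let u⁻ : ℝ → ℝⁿ be C^∞ on (−∞,0] and satisfy derivWithin u⁻ (−∞,0] x = f(u⁻(x)) for all x ≤ 0; and suppose u⁺(0) = u⁻(0). Then the glued function u, defined by u(x) = u⁺(x) for x ≥ 0 and u(x) = u⁻(x) for x < 0, is C^∞ on ℝ and satisfies u'(x) = f(u(x)) for every x ∈ ℝ. -/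
theorem ContDiff.of_hasDerivAt_autonomous {E : Type*} [NormedAddCommGroup E] [NormedSpace ℝ E]
    {f : E → E} {u : ℝ → E} (hf : ContDiff ℝ (⊤ : ℕ∞) f) (hu : ∀ x, HasDerivAt u (f (u x)) x) :
    ContDiff ℝ (⊤ : ℕ∞) u := by
  have hderiv : deriv u = f ∘ u := funext fun x => (hu x).deriv
  refine contDiff_infty.2 fun m => ?_
  induction m with
  | zero =>
    exact contDiff_zero.2 (continuous_iff_continuousAt.2 fun x => (hu x).continuousAt)
  | succ k ih =>
    push_cast
    refine contDiff_succ_iff_deriv.2 ⟨fun x => (hu x).differentiableAt, by simp, ?_⟩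
    rw [hderiv]
    exact (contDiff_infty.1 hf k).comp ih

theorem HasDerivAt.of_Ici_of_Iic {E : Type*} [NormedAddCommGroup E] [NormedSpace ℝ E]
    {u u' : ℝ → E} {a : ℝ}
    (hright : ∀ x, a ≤ x → HasDerivWithinAt u (u' x) (Set.Ici a) x)
    (hleft : ∀ x, x ≤ a → HasDerivWithinAt u (u' x) (Set.Iic a) x) (x : ℝ) :
    HasDerivAt u (u' x) x := by
  rcases lt_trichotomy x a with h | rfl | h
  · exact (hleft x h.le).hasDerivAt (Iic_mem_nhds h)
  · simpa using (hleft x le_rfl).union (hright x le_rfl)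
  · exact (hright x h.le).hasDerivAt (Ici_mem_nhds h)

theorem glue_first_order_ODE_solutions
    (n : ℕ) (f : (Fin n → ℝ) → (Fin n → ℝ)) (hf : ContDiff ℝ (⊤ : ℕ∞) f)
    (uP uM : ℝ → (Fin n → ℝ))
    (hP : ContDiffOn ℝ (⊤ : ℕ∞) uP (Set.Ici (0 : ℝ)))
    (hPode : ∀ x : ℝ, 0 ≤ x → derivWithin uP (Set.Ici (0 : ℝ)) x = f (uP x))
    (hM : ContDiffOn ℝ (⊤ : ℕ∞) uM (Set.Iic (0 : ℝ)))
    (hMode : ∀ x : ℝ, x ≤ 0 → derivWithin uM (Set.Iic (0 : ℝ)) x = f (uM x))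
    (hmatch : uP 0 = uM 0)
    (u : ℝ → (Fin n → ℝ))
    (hu : ∀ x : ℝ, u x = if 0 ≤ x then uP x else uM x) :
    ContDiff ℝ (⊤ : ℕ∞) u ∧ ∀ x : ℝ, deriv u x = f (u x) := by
  have eqP : Set.EqOn u uP (Set.Ici 0) := fun x hx => by rw [hu, if_pos (Set.mem_Ici.1 hx)]
  have eqM : Set.EqOn u uM (Set.Iic 0) := fun x hx => by
    rcases (Set.mem_Iic.1 hx).lt_or_eq with h | rfl
    · rw [hu, if_neg h.not_ge]
    · rw [hu, if_pos le_rfl, hmatch]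
  have hasDeriv : ∀ x, HasDerivAt u (f (u x)) x := by
    refine HasDerivAt.of_Ici_of_Iic (u' := fun x => f (u x)) (a := 0)
      (fun x hx => ?_) (fun x hx => ?_)
    · have h := (hP.differentiableOn (by simp) x hx).hasDerivWithinAt
      rw [hPode x hx, ← eqP hx] at h
      exact h.congr eqP (eqP hx)
    · have h := (hM.differentiableOn (by simp) x hx).hasDerivWithinAt
      rw [hMode x hx, ← eqM hx] at h
      exact h.congr eqM (eqM hx)
  exact ⟨hf.of_hasDerivAt_autonomous hasDeriv, fun x => (hasDeriv x).deriv⟩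
end

section
/- Let n ∈ ℕ and let f : ℝⁿ → ℝⁿ be C^∞. Let u⁺ : ℝ → ℝⁿ be C^∞ on [0,∞) satisfying the one-sided ODE derivWithin u⁺ [0,∞) x = f(u⁺(x)) for all x ≥ 0, and let u⁻ : ℝ → ℝⁿ be C^∞ on (−∞,0] satisfying derivWithin u⁻ (−∞,0] x = f(u⁻(x)) for all x ≤ 0, with u⁺(0) = u⁻(0). Then for every natural number k, the one-sided iterated derivatives at 0 agree: iteratedDerivWithin k u⁺ [0,∞) 0 = iteratedDerivWithin k u⁻ (−∞,0] 0. -/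
/-- The iterates of the Lie derivative along the vector field `f`, applied to the identity map. -/
noncomputable def iteratedLieDeriv {E : Type*} [NormedAddCommGroup E] [NormedSpace ℝ E]
    (f : E → E) : ℕ → E → E
  | 0 => id
  | k + 1 => fun y => fderiv ℝ (iteratedLieDeriv f k) y (f y)

theorem contDiff_iteratedLieDeriv {E : Type*} [NormedAddCommGroup E] [NormedSpace ℝ E]
    {f : E → E} (hf : ContDiff ℝ (⊤ : ℕ∞) f) (k : ℕ) :
    ContDiff ℝ (⊤ : ℕ∞) (iteratedLieDeriv f k) := by
  induction k with
  | zero => exact contDiff_id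
  | succ k ih => exact (ih.fderiv_right (by simp)).clm_apply hf

/-- The iterated derivatives of a solution of `u' = f(u)` are functions of the value of `u`. -/
theorem iteratedDerivWithin_eq_iteratedLieDeriv
    {E : Type*} [NormedAddCommGroup E] [NormedSpace ℝ E]
    {f : E → E} (hf : ContDiff ℝ (⊤ : ℕ∞) f) {s : Set ℝ} (hs : UniqueDiffOn ℝ s) {u : ℝ → E}
    (hu : DifferentiableOn ℝ u s) (hode : ∀ x ∈ s, derivWithin u s x = f (u x)) (k : ℕ) :
    ∀ x ∈ s, iteratedDerivWithin k u s x = iteratedLieDeriv f k (u x) := by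
  induction k with
  | zero => intro x _; simp [iteratedLieDeriv]
  | succ k ih =>
    intro x hx
    rw [iteratedDerivWithin_succ, derivWithin_congr ih (ih x hx)]
    have hG : HasFDerivAt (iteratedLieDeriv f k) (fderiv ℝ (iteratedLieDeriv f k) (u x)) (u x) :=
      ((contDiff_iteratedLieDeriv hf k).differentiable (by simp) (u x)).hasFDerivAt
    have h := (hG.comp_hasDerivWithinAt x (hu x hx).hasDerivWithinAt).derivWithin (hs x hx)
    rw [hode x hx] at h
    exact h

theorem one_sided_derivatives_match_of_first_order_ODE
    (n : ℕ) (f : (Fin n → ℝ) → (Fin n → ℝ)) (hf : ContDiff ℝ (⊤ : ℕ∞) f)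
    (uP uM : ℝ → (Fin n → ℝ))
    (hP : ContDiffOn ℝ (⊤ : ℕ∞) uP (Set.Ici (0 : ℝ)))
    (hPode : ∀ x : ℝ, 0 ≤ x → derivWithin uP (Set.Ici (0 : ℝ)) x = f (uP x))
    (hM : ContDiffOn ℝ (⊤ : ℕ∞) uM (Set.Iic (0 : ℝ)))
    (hMode : ∀ x : ℝ, x ≤ 0 → derivWithin uM (Set.Iic (0 : ℝ)) x = f (uM x))
    (hmatch : uP 0 = uM 0) :
    ∀ k : ℕ,
      iteratedDerivWithin k uP (Set.Ici (0 : ℝ)) 0 =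
        iteratedDerivWithin k uM (Set.Iic (0 : ℝ)) 0 := by
  intro k
  rw [iteratedDerivWithin_eq_iteratedLieDeriv hf (uniqueDiffOn_Ici 0)
      (hP.differentiableOn (by simp)) hPode k 0 Set.self_mem_Ici,
    iteratedDerivWithin_eq_iteratedLieDeriv hf (uniqueDiffOn_Iic 0)
      (hM.differentiableOn (by simp)) hMode k 0 Set.self_mem_Iic, hmatch]
end

section
/- Let n ∈ ℕ and let g : ℝⁿ × ℝⁿ → ℝⁿ be C^∞. Let v⁺ : ℝ → ℝⁿ be C^∞ on [0,∞) and satisfy the one-sided second-order ODE derivWithin (derivWithin v⁺ [0,∞)) [0,∞) x = g(v⁺(x), derivWithin v⁺ [0,∞) x) for all x ≥ 0; let v⁻ : ℝ → ℝⁿ satisfy the analogous equation on (−∞,0]; and suppose v⁺(0) = v⁻(0) and derivWithin v⁺ [0,∞) 0 = derivWithin v⁻ (−∞,0] 0. Then the glued function v, defined by v(x) = v⁺(x) for x ≥ 0 and v(x) = v⁻(x) for x < 0, is C^∞ on ℝ and satisfies v''(x) = g(v(x), v'(x)) for every x ∈ ℝ. -/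
/-- A function that agrees with `f` on `[a, ∞)` and with `h` on `(-∞, a]`, where `f` and `h` have
matching one-sided derivatives at `a`, is differentiable with the glued derivative. -/
theorem hasDerivAt_ite_of_differentiableOn_Ici_Iic {E : Type*} [NormedAddCommGroup E]
    [NormedSpace ℝ E] {a : ℝ} {f h : ℝ → E} (hf : DifferentiableOn ℝ f (Set.Ici a))
    (hh : DifferentiableOn ℝ h (Set.Iic a)) (h₀ : f a = h a)
    (h₁ : derivWithin f (Set.Ici a) a = derivWithin h (Set.Iic a) a) (x : ℝ) :
    HasDerivAt (fun y => if a ≤ y then f y else h y)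
      (if a ≤ x then derivWithin f (Set.Ici a) x else derivWithin h (Set.Iic a) x) x := by
  set u : ℝ → E := fun y => if a ≤ y then f y else h y
  have hu_Ici : ∀ y ∈ Set.Ici a, u y = f y := fun y hy => if_pos hy
  have hu_Iic : ∀ y ∈ Set.Iic a, u y = h y := fun y hy => by
    rcases (Set.mem_Iic.1 hy).eq_or_lt with rfl | hlt
    · exact (if_pos le_rfl).trans h₀
    · exact if_neg hlt.not_ge
  have hP : ∀ y ∈ Set.Ici a,
      HasDerivWithinAt u (derivWithin f (Set.Ici a) y) (Set.Ici a) y := fun y hy =>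
    (hf y hy).hasDerivWithinAt.congr hu_Ici (hu_Ici y hy)
  have hM : ∀ y ∈ Set.Iic a,
      HasDerivWithinAt u (derivWithin h (Set.Iic a) y) (Set.Iic a) y := fun y hy =>
    (hh y hy).hasDerivWithinAt.congr hu_Iic (hu_Iic y hy)
  rcases lt_trichotomy x a with hx | rfl | hx
  · rw [if_neg hx.not_ge]
    exact (hM x hx.le).hasDerivAt (Iic_mem_nhds hx)
  · rw [if_pos le_rfl]
    have hl := hM x Set.self_mem_Iic
    rw [← h₁] at hl
    simpa using hl.union (hP x Set.self_mem_Ici)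
  · rw [if_pos hx.le]
    exact (hP x hx.le).hasDerivAt (Ici_mem_nhds hx)

/-- A global solution of an autonomous ODE with smooth right-hand side is smooth. -/
theorem contDiff_infty_of_hasDerivAt_autonomous {E : Type*} [NormedAddCommGroup E]
    [NormedSpace ℝ E] {F : E → E} (hF : ContDiff ℝ (⊤ : ℕ∞) F) {w : ℝ → E}
    (hw : ∀ x, HasDerivAt w (F (w x)) x) : ContDiff ℝ (⊤ : ℕ∞) w := by
  have hd : Differentiable ℝ w := fun x => (hw x).differentiableAt
  have hderiv : deriv w = F ∘ w := funext fun x => (hw x).deriv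
  refine contDiff_infty.2 fun k => ?_
  induction k with
  | zero => exact contDiff_zero.2 hd.continuous
  | succ k ih =>
    push_cast
    refine contDiff_succ_iff_deriv.2 ⟨hd, by simp, ?_⟩
    rw [hderiv]
    exact (contDiff_infty.1 hF k).comp ih


theorem glue_second_order_ODE_solutions
    (n : ℕ) (g : (Fin n → ℝ) × (Fin n → ℝ) → (Fin n → ℝ))
    (hg : ContDiff ℝ (⊤ : ℕ∞) g)
    (vP vM : ℝ → (Fin n → ℝ))
    (hP : ContDiffOn ℝ (⊤ : ℕ∞) vP (Set.Ici (0 : ℝ)))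
    (hPode : ∀ x : ℝ, 0 ≤ x →
      derivWithin (derivWithin vP (Set.Ici (0 : ℝ))) (Set.Ici (0 : ℝ)) x =
        g (vP x, derivWithin vP (Set.Ici (0 : ℝ)) x))
    (hM : ContDiffOn ℝ (⊤ : ℕ∞) vM (Set.Iic (0 : ℝ)))
    (hMode : ∀ x : ℝ, x ≤ 0 →
      derivWithin (derivWithin vM (Set.Iic (0 : ℝ))) (Set.Iic (0 : ℝ)) x =
        g (vM x, derivWithin vM (Set.Iic (0 : ℝ)) x))
    (hmatch0 : vP 0 = vM 0)
    (hmatch1 : derivWithin vP (Set.Ici (0 : ℝ)) 0 = derivWithin vM (Set.Iic (0 : ℝ)) 0)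
    (v : ℝ → (Fin n → ℝ))
    (hv : ∀ x : ℝ, v x = if 0 ≤ x then vP x else vM x) :
    ContDiff ℝ (⊤ : ℕ∞) v ∧
      ∀ x : ℝ, deriv (deriv v) x = g (v x, deriv v x) := by
  obtain ⟨hPd, hPs⟩ := (contDiffOn_infty_iff_derivWithin (uniqueDiffOn_Ici (0 : ℝ))).1 hP
  obtain ⟨hMd, hMs⟩ := (contDiffOn_infty_iff_derivWithin (uniqueDiffOn_Iic (0 : ℝ))).1 hM
  obtain rfl : v = fun x => if 0 ≤ x then vP x else vM x := funext hv
  set v : ℝ → (Fin n → ℝ) := fun x => if 0 ≤ x then vP x else vM x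
  set v' : ℝ → (Fin n → ℝ) := fun x => if 0 ≤ x then derivWithin vP (Set.Ici 0) x
    else derivWithin vM (Set.Iic 0) x
  have hd : ∀ x, HasDerivAt v (v' x) x :=
    hasDerivAt_ite_of_differentiableOn_Ici_Iic hPd hMd hmatch0 hmatch1
  have hd' : ∀ x, HasDerivAt v' (g (v x, v' x)) x := fun x => by
    refine (hasDerivAt_ite_of_differentiableOn_Ici_Iic (hPs.differentiableOn (by simp))
      (hMs.differentiableOn (by simp)) hmatch1
      (by rw [hPode 0 le_rfl, hMode 0 le_rfl, hmatch0, hmatch1]) x).congr_deriv ?_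
    by_cases hx : 0 ≤ x
    · simp only [v, v', if_pos hx, hPode x hx]
    · simp only [v, v', if_neg hx, hMode x (not_le.1 hx).le]
  have hderiv : deriv v = v' := funext fun x => (hd x).deriv
  refine ⟨?_, fun x => by rw [hderiv, (hd' x).deriv]⟩
  exact (contDiff_infty_of_hasDerivAt_autonomous (F := fun p => (p.2, g p))
    (contDiff_snd.prodMk hg) (w := fun x => (v x, v' x))
    fun x => (hd x).prodMk (hd' x)).fst
end

section
/- Let m, n ∈ ℕ and let F : ℝᵐ × ℝⁿ × ℝⁿ → ℝᵐ and G : ℝᵐ × ℝⁿ × ℝⁿ → ℝⁿ be C^∞. Suppose u⁺ : ℝ → ℝᵐ and v⁺ : ℝ → ℝⁿ are C^∞ on [0,∞) and satisfy, with one-sided derivatives within [0,∞): u⁺' (x) = F(u⁺(x), v⁺(x), v⁺'(x)) and v⁺''(x) = G(u⁺(x), v⁺(x), v⁺'(x)) for all x ≥ 0; suppose u⁻, v⁻ satisfy the analogous equations on (−∞,0]; and suppose u⁺(0) = u⁻(0), v⁺(0) = v⁻(0), and the one-sided derivatives satisfy derivWithin v⁺ [0,∞) 0 = derivWithin v⁻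 (−∞,0] 0. Then the glued functions u and v (equal to the '+' branches on [0,∞) and the '−' branches on (−∞,0)) are C^∞ on ℝ and satisfy u' = F(u,v,v') and v'' = G(u,v,v') everywhere on ℝ. -/
theorem eqOn_Ici_of_eq_ite {E : Type*} {f p q : ℝ → E} {a : ℝ}
    (hf : ∀ x, f x = if a ≤ x then p x else q x) : Set.EqOn f p (Set.Ici a) :=
  fun x hx => (hf x).trans (if_pos hx)

theorem eqOn_Iic_of_eq_ite {E : Type*} {f p q : ℝ → E} {a : ℝ}
    (hf : ∀ x, f x = if a ≤ x then p x else q x) (hpq : p a = q a) :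
    Set.EqOn f q (Set.Iic a) := fun x hx => by
  rcases (Set.mem_Iic.1 hx).lt_or_eq with h | rfl
  · exact (hf x).trans (if_neg h.not_ge)
  · exact (hf x).trans ((if_pos le_rfl).trans hpq)

/-- Two functions with one-sided derivatives that agree at `a`, with the same derivative there, glue
to a differentiable function. -/
theorem hasDerivAt_of_eqOn_Ici_Iic {E : Type*} [NormedAddCommGroup E] [NormedSpace ℝ E]
    {f p q g : ℝ → E} {a : ℝ}
    (hfp : Set.EqOn f p (Set.Ici a)) (hfq : Set.EqOn f q (Set.Iic a))
    (hp : ∀ x, a ≤ x → HasDerivWithinAt p (g x) (Set.Ici a) x)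
    (hq : ∀ x, x ≤ a → HasDerivWithinAt q (g x) (Set.Iic a) x) (x : ℝ) :
    HasDerivAt f (g x) x := by
  have hP : ∀ y, a ≤ y → HasDerivWithinAt f (g y) (Set.Ici a) y :=
    fun y hy => (hp y hy).congr hfp (hfp hy)
  have hQ : ∀ y, y ≤ a → HasDerivWithinAt f (g y) (Set.Iic a) y :=
    fun y hy => (hq y hy).congr hfq (hfq hy)
  rcases lt_trichotomy x a with h | rfl | h
  · exact (hQ x h.le).hasDerivAt (Iic_mem_nhds h)
  · have := (hQ x le_rfl).union (hP x le_rfl)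
    rwa [Set.Iic_union_Ici, hasDerivWithinAt_univ] at this
  · exact (hP x h.le).hasDerivAt (Ici_mem_nhds h)

/-- A solution of an autonomous ODE with smooth right-hand side is smooth. -/
theorem contDiff_of_hasDerivAt_comp_self {E : Type*} [NormedAddCommGroup E] [NormedSpace ℝ E]
    {H : E → E} (hH : ContDiff ℝ (⊤ : ℕ∞) H) {y : ℝ → E}
    (hy : ∀ x, HasDerivAt y (H (y x)) x) : ContDiff ℝ (⊤ : ℕ∞) y := by
  have hd : deriv y = H ∘ y := funext fun x => (hy x).deriv
  have hdiff : Differentiable ℝ y := fun x => (hy x).differentiableAt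
  rw [contDiff_infty]
  intro k
  induction k with
  | zero => exact contDiff_zero.2 hdiff.continuous
  | succ k ih =>
    rw [Nat.cast_add, Nat.cast_one, contDiff_succ_iff_deriv]
    refine ⟨hdiff, by simp, ?_⟩
    rw [hd]
    exact (contDiff_infty.1 hH k).comp ih

theorem glue_coupled_first_and_second_order_ODE_solutions
    (m n : ℕ)
    (F : (Fin m → ℝ) × (Fin n → ℝ) × (Fin n → ℝ) → (Fin m → ℝ))
    (G : (Fin m → ℝ) × (Fin n → ℝ) × (Fin n → ℝ) → (Fin n → ℝ))
    (hF : ContDiff ℝ (⊤ : ℕ∞) F) (hG : ContDiff ℝ (⊤ : ℕ∞) G)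
    (uP uM : ℝ → (Fin m → ℝ)) (vP vM : ℝ → (Fin n → ℝ))
    (huP : ContDiffOn ℝ (⊤ : ℕ∞) uP (Set.Ici (0 : ℝ)))
    (hvP : ContDiffOn ℝ (⊤ : ℕ∞) vP (Set.Ici (0 : ℝ)))
    (hPode1 : ∀ x : ℝ, 0 ≤ x →
      derivWithin uP (Set.Ici (0 : ℝ)) x =
        F (uP x, vP x, derivWithin vP (Set.Ici (0 : ℝ)) x))
    (hPode2 : ∀ x : ℝ, 0 ≤ x →
      derivWithin (derivWithin vP (Set.Ici (0 : ℝ))) (Set.Ici (0 : ℝ)) x =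
        G (uP x, vP x, derivWithin vP (Set.Ici (0 : ℝ)) x))
    (huM : ContDiffOn ℝ (⊤ : ℕ∞) uM (Set.Iic (0 : ℝ)))
    (hvM : ContDiffOn ℝ (⊤ : ℕ∞) vM (Set.Iic (0 : ℝ)))
    (hMode1 : ∀ x : ℝ, x ≤ 0 →
      derivWithin uM (Set.Iic (0 : ℝ)) x =
        F (uM x, vM x, derivWithin vM (Set.Iic (0 : ℝ)) x))
    (hMode2 : ∀ x : ℝ, x ≤ 0 →
      derivWithin (derivWithin vM (Set.Iic (0 : ℝ))) (Set.Iic (0 : ℝ)) x =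
        G (uM x, vM x, derivWithin vM (Set.Iic (0 : ℝ)) x))
    (hmatchu : uP 0 = uM 0)
    (hmatchv : vP 0 = vM 0)
    (hmatchv' : derivWithin vP (Set.Ici (0 : ℝ)) 0 = derivWithin vM (Set.Iic (0 : ℝ)) 0)
    (u : ℝ → (Fin m → ℝ)) (v : ℝ → (Fin n → ℝ))
    (hu : ∀ x : ℝ, u x = if 0 ≤ x then uP x else uM x)
    (hv : ∀ x : ℝ, v x = if 0 ≤ x then vP x else vM x) :
    ContDiff ℝ (⊤ : ℕ∞) u ∧ ContDiff ℝ (⊤ : ℕ∞) v ∧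
      (∀ x : ℝ, deriv u x = F (u x, v x, deriv v x)) ∧
      (∀ x : ℝ, deriv (deriv v) x = G (u x, v x, deriv v x)) := by
  have huI := eqOn_Ici_of_eq_ite hu
  have hvI := eqOn_Ici_of_eq_ite hv
  have huJ := eqOn_Iic_of_eq_ite hu hmatchu
  have hvJ := eqOn_Iic_of_eq_ite hv hmatchv
  obtain ⟨w, hw⟩ : ∃ w : ℝ → (Fin n → ℝ), ∀ x, w x =
      if 0 ≤ x then derivWithin vP (Set.Ici 0) x else derivWithin vM (Set.Iic 0) x :=
    ⟨_, fun _ => rfl⟩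
  have hwI := eqOn_Ici_of_eq_ite hw
  have hwJ := eqOn_Iic_of_eq_ite hw hmatchv'
  have htop : ((⊤ : ℕ∞) : WithTop ℕ∞) ≠ 0 := by simp
  have hvP' : ContDiffOn ℝ (⊤ : ℕ∞) (derivWithin vP (Set.Ici 0)) (Set.Ici 0) :=
    hvP.derivWithin (uniqueDiffOn_Ici 0) (by simp)
  have hvM' : ContDiffOn ℝ (⊤ : ℕ∞) (derivWithin vM (Set.Iic 0)) (Set.Iic 0) :=
    hvM.derivWithin (uniqueDiffOn_Iic 0) (by simp)
  have hu' : ∀ x, HasDerivAt u (F (u x, v x, w x)) x := by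
    refine hasDerivAt_of_eqOn_Ici_Iic huI huJ (fun x hx => ?_) fun x hx => ?_
    · rw [huI hx, hvI hx, hwI hx, ← hPode1 x hx]
      exact (huP.differentiableOn htop x hx).hasDerivWithinAt
    · rw [huJ hx, hvJ hx, hwJ hx, ← hMode1 x hx]
      exact (huM.differentiableOn htop x hx).hasDerivWithinAt
  have hv' : ∀ x, HasDerivAt v (w x) x := by
    refine hasDerivAt_of_eqOn_Ici_Iic hvI hvJ (fun x hx => ?_) fun x hx => ?_
    · rw [hwI hx]
      exact (hvP.differentiableOn htop x hx).hasDerivWithinAt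
    · rw [hwJ hx]
      exact (hvM.differentiableOn htop x hx).hasDerivWithinAt
  have hw' : ∀ x, HasDerivAt w (G (u x, v x, w x)) x := by
    refine hasDerivAt_of_eqOn_Ici_Iic hwI hwJ (fun x hx => ?_) fun x hx => ?_
    · rw [huI hx, hvI hx, hwI hx, ← hPode2 x hx]
      exact (hvP'.differentiableOn htop x hx).hasDerivWithinAt
    · rw [huJ hx, hvJ hx, hwJ hx, ← hMode2 x hx]
      exact (hvM'.differentiableOn htop x hx).hasDerivWithinAt
  have hdv : deriv v = w := funext fun x => (hv' x).deriv
  have hsmooth : ContDiff ℝ (⊤ : ℕ∞) fun x => (u x, v x, w x) :=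
    contDiff_of_hasDerivAt_comp_self (H := fun z => (F z, z.2.2, G z))
      (hF.prodMk (contDiff_snd.snd.prodMk hG))
      fun x => (hu' x).prodMk ((hv' x).prodMk (hw' x))
  refine ⟨hsmooth.fst, hsmooth.snd.fst, fun x => ?_, fun x => ?_⟩
  · rw [hdv, (hu' x).deriv]
  · rw [hdv, (hw' x).deriv]
end

section
/- Let F₁ : ℝ → ℝ be continuous with F₁(x) > 0 for all x, C^∞ on [0,∞) and on (−∞,0] (with one-sided derivatives at 0), and suppose the one-sided derivatives a⁺ := derivWithin F₁ [0,∞) 0 and a⁻ := derivWithin F₁ (−∞,0] 0 satisfy a⁺ ≠ a⁻. Define s(r) := ∫₀ʳ F₁(u) du, let ρ be the inverse of s on its range, fix r₀ > 0, and set F₂(x) := √(x² + r₀²) and G := F₂ ∘ ρ. Then the one-sided third derivatives of G at 0 exist and satisfy G'''(0⁺) − G'''(0⁻) = −3(a⁺ − a⁻)/(r₀ · F₁(0)⁴) ≠ 0. Consequently G is not three times continuously differentiable on any neighborhood of 0. -/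
open Filter Topology Set

/-- Chain rule for one-sided derivatives: if `g = φ ∘ ρ` on `S` near `0` and `ρ' = 1 / (F ∘ ρ)`, then
`g' = (φ' / F) ∘ ρ` on `S` near `0`. -/
theorem eventually_hasDerivWithinAt_of_eq_comp {S : Set ℝ} {F ρ φ g : ℝ → ℝ}
    (hρd : ∀ᶠ y in 𝓝[S] 0, HasDerivAt ρ (F (ρ y))⁻¹ y)
    (hρS : ∀ᶠ y in 𝓝[S] 0, ρ y ∈ S) (hφ : DifferentiableOn ℝ φ S)
    (hg : ∀ᶠ y in 𝓝[S] 0, g y = φ (ρ y)) :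
    ∀ᶠ y in 𝓝[S] 0, HasDerivWithinAt g (derivWithin φ S (ρ y) / F (ρ y)) S y := by
  filter_upwards [hρd, hρS, hg, eventually_eventually_nhdsWithin.2 hρS,
    eventually_eventually_nhdsWithin.2 hg] with y h1 h2 h3 h4 h5
  have hd : HasDerivWithinAt φ (derivWithin φ S (ρ y)) S (ρ y) :=
    (hφ _ h2).hasDerivWithinAt
  have ht : Tendsto ρ (𝓝[S] y) (𝓝[S] (ρ y)) :=
    tendsto_nhdsWithin_iff.2 ⟨h1.continuousAt.tendsto.mono_left nhdsWithin_le_nhds, h4⟩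
  have hmaps : HasDerivWithinAt (φ ∘ ρ) (derivWithin φ S (ρ y) * (F (ρ y))⁻¹) (S ∩ ρ ⁻¹' S) y :=
    hd.comp y (h1.hasDerivWithinAt) (fun z hz => hz.2)
  have hmem : S ∩ ρ ⁻¹' S ∈ 𝓝[S] y := inter_mem self_mem_nhdsWithin h4
  rw [div_eq_mul_inv]
  exact (hmaps.mono_of_mem_nhdsWithin hmem).congr_of_eventuallyEq h5 h3

/-- The one-sided third derivative at the throat of the areal radius `√(ρ² + r₀²)`. -/
theorem hasDerivWithinAt_areal_radius_third {S : Set ℝ} (hS : UniqueDiffOn ℝ S)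
    (h0 : (0 : ℝ) ∈ S) {F ρ : ℝ → ℝ} (hF : ContDiffOn ℝ (⊤ : ℕ∞) F S) (hpos : ∀ x, 0 < F x)
    (hρ0 : ρ 0 = 0) (hρd : ∀ᶠ y in 𝓝[S] 0, HasDerivAt ρ (F (ρ y))⁻¹ y)
    (hρS : ∀ᶠ y in 𝓝[S] 0, ρ y ∈ S) {r₀ : ℝ} (hr₀ : 0 < r₀) :
    HasDerivWithinAt
      (derivWithin (derivWithin (fun y => Real.sqrt (ρ y ^ 2 + r₀ ^ 2)) S) S)
      (-3 * derivWithin F S 0 / (r₀ * F 0 ^ 4)) S 0 := by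
  have hq : ∀ x : ℝ, 0 < x ^ 2 + r₀ ^ 2 := fun x => by positivity
  set f : ℝ → ℝ := fun x => Real.sqrt (x ^ 2 + r₀ ^ 2) with hf
  have hfpos : ∀ x, 0 < f x := fun x => Real.sqrt_pos.2 (hq x)
  have hfC : ContDiff ℝ (⊤ : ℕ∞) f :=
    ContDiff.sqrt (by fun_prop) (fun x => (hq x).ne')
  have hfd : ∀ x, HasDerivAt f (x / f x) x := fun x => by
    have hsq : HasDerivAt (fun x : ℝ => x ^ 2 + r₀ ^ 2) (2 * x) x := by
      simpa using (hasDerivAt_pow 2 x).add_const (r₀ ^ 2)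
    simpa only [mul_div_mul_left _ _ (two_ne_zero' ℝ)] using hsq.sqrt (hq x).ne'
  have hf0 : f 0 = r₀ := by simp [hf, Real.sqrt_sq hr₀.le]
  set m : ℝ → ℝ := fun x => (f x * F x)⁻¹ with hm
  have hmC : ContDiffOn ℝ (⊤ : ℕ∞) m S :=
    (hfC.contDiffOn.mul hF).inv fun x _ => (mul_pos (hfpos x) (hpos x)).ne'
  have htop : ((⊤ : ℕ∞) : WithTop ℕ∞) ≠ 0 := by simp
  have hm'C : ContDiffOn ℝ 1 (derivWithin m S) S :=
    hmC.derivWithin hS (WithTop.coe_le_coe.2 (le_top : (1 + 1 : ℕ∞) ≤ ⊤))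
  have hmd := hmC.differentiableOn htop
  have hm'd := hm'C.differentiableOn one_ne_zero
  have hFd := hF.differentiableOn htop
  have hFinv : DifferentiableOn ℝ (fun x => (F x)⁻¹) S := hFd.inv fun x _ => (hpos x).ne'
  have hG1 := eventually_hasDerivWithinAt_of_eq_comp hρd hρS
    (φ := f) (g := fun y => f (ρ y)) (fun x _ => (hfd x).differentiableAt.differentiableWithinAt)
    (.of_forall fun _ => rfl)
  have hG1' : ∀ᶠ y in 𝓝[S] 0, derivWithin (fun y => f (ρ y)) S y = ρ y * m (ρ y) := by
    filter_upwards [hG1, hρS, self_mem_nhdsWithin] with y h1 h2 h3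
    rw [h1.derivWithin (hS y h3), (hfd _).hasDerivWithinAt.derivWithin (hS _ h2)]
    simp only [hm, mul_inv, div_eq_mul_inv, mul_assoc]
  have hHd : ∀ x ∈ S, HasDerivWithinAt (fun x => x * m x) (m x + x * derivWithin m S x) S x :=
    fun x hx => by
      have h := (hasDerivAt_id' x).hasDerivWithinAt.mul (hmd x hx).hasDerivWithinAt
      rw [one_mul] at h
      exact h
  have hG2 := eventually_hasDerivWithinAt_of_eq_comp hρd hρS
    (φ := fun x => x * m x) (fun x hx => (hHd x hx).differentiableWithinAt) hG1'
  have hG2' : ∀ᶠ y in 𝓝[S] 0, derivWithin (derivWithin (fun y => f (ρ y)) S) S y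
      = (fun x => (m x + x * derivWithin m S x) * (F x)⁻¹) (ρ y) := by
    filter_upwards [hG2, hρS, self_mem_nhdsWithin] with y h1 h2 h3
    rw [h1.derivWithin (hS y h3), (hHd _ h2).derivWithin (hS _ h2), div_eq_mul_inv]
  have hG3 := (eventually_hasDerivWithinAt_of_eq_comp hρd hρS
    (φ := fun x => (m x + x * derivWithin m S x) * (F x)⁻¹)
    ((hmd.add (differentiableOn_id.mul hm'd)).mul hFinv) hG2').self_of_nhdsWithin h0
  have hF0 : F 0 ≠ 0 := (hpos 0).ne'
  have hFd0 := (hFd 0 h0).hasDerivWithinAt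
  have hfd0 : HasDerivWithinAt f 0 S 0 := by simpa using (hfd 0).hasDerivWithinAt (s := S)
  have hm0 : derivWithin m S 0 = -(r₀ * derivWithin F S 0) / (r₀ * F 0) ^ 2 := by
    have h : HasDerivWithinAt m _ S 0 := (hfd0.mul hFd0).inv (mul_pos (hfpos 0) (hpos 0)).ne'
    simpa [hf0] using h.derivWithin (hS 0 h0)
  have hK := ((hmd 0 h0).hasDerivWithinAt.add
    ((hasDerivWithinAt_id 0 S).mul (hm'd 0 h0).hasDerivWithinAt)).mul (hFd0.inv hF0)
  have hK' := hK.derivWithin (hS 0 h0)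
  rw [hρ0] at hG3
  convert hG3 using 1
  refine Eq.trans ?_ (congrArg (· / F 0) hK'.symm)
  simp only [Pi.add_apply, Pi.mul_apply, Pi.inv_apply, id, hm0]
  simp only [hm, hf0]
  field_simp
  ring

/-- For a function that is `C³` at `0`, every one-sided third derivative is the third derivative. -/
theorem ContDiffAt.hasDerivWithinAt_derivWithin_derivWithin {G : ℝ → ℝ} (hG : ContDiffAt ℝ 3 G 0)
    {S : Set ℝ} (hS : UniqueDiffOn ℝ S) (h0 : (0 : ℝ) ∈ S) :
    HasDerivWithinAt (derivWithin (derivWithin G S) S) (deriv (deriv (deriv G)) 0) S 0 := by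
  have h1 : ContDiffAt ℝ 2 (deriv G) 0 :=
    (hG.fderiv_right (m := 2) (by norm_num)).clm_apply contDiffAt_const
  have h2 : ContDiffAt ℝ 1 (deriv (deriv G)) 0 :=
    (h1.fderiv_right (m := 1) (by norm_num)).clm_apply contDiffAt_const
  have key : ∀ {g h : ℝ → ℝ} {n : WithTop ℕ∞}, n ≠ 0 → n ≠ (⊤ : ℕ∞) → ContDiffAt ℝ n h 0 →
      g =ᶠ[𝓝[S] 0] h → derivWithin g S =ᶠ[𝓝[S] 0] deriv h := by
    intro g h n hn hn' hh hgh
    have hev := (hh.eventually hn').filter_mono (nhdsWithin_le_nhds (s := S))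
    filter_upwards [hev, hgh, eventually_eventually_nhdsWithin.2 hgh, self_mem_nhdsWithin]
      with y a b c d
    rw [EventuallyEq.derivWithin_eq c b]
    exact (a.differentiableAt hn).derivWithin (hS y d)
  have e2 := key (by norm_num) (by decide) h1 (key (by norm_num) (by decide) hG .rfl)
  exact (h2.differentiableAt one_ne_zero).hasDerivAt.hasDerivWithinAt.congr_of_eventuallyEq e2
    (e2.self_of_nhdsWithin h0)


theorem BSKR_areal_radius_not_C3_at_throat
    (F₁ : ℝ → ℝ) (hcont : Continuous F₁) (hpos : ∀ x : ℝ, 0 < F₁ x)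
    (hP : ContDiffOn ℝ (⊤ : ℕ∞) F₁ (Set.Ici (0 : ℝ)))
    (hM : ContDiffOn ℝ (⊤ : ℕ∞) F₁ (Set.Iic (0 : ℝ)))
    (aP aM : ℝ)
    (haP : aP = derivWithin F₁ (Set.Ici (0 : ℝ)) 0)
    (haM : aM = derivWithin F₁ (Set.Iic (0 : ℝ)) 0)
    (hne : aP ≠ aM)
    (s : ℝ → ℝ) (hs : ∀ r : ℝ, s r = ∫ u in (0 : ℝ)..r, F₁ u)
    (ρ : ℝ → ℝ) (hρ : ∀ r : ℝ, ρ (s r) = r)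
    (r₀ : ℝ) (hr₀ : 0 < r₀)
    (F₂ : ℝ → ℝ) (hF₂ : ∀ x : ℝ, F₂ x = Real.sqrt (x ^ 2 + r₀ ^ 2))
    (G : ℝ → ℝ) (hG : G = F₂ ∘ ρ) :
    (∃ cP cM : ℝ,
      HasDerivWithinAt (derivWithin (derivWithin G (Set.Ici (0 : ℝ))) (Set.Ici (0 : ℝ)))
        cP (Set.Ici (0 : ℝ)) 0 ∧
      HasDerivWithinAt (derivWithin (derivWithin G (Set.Iic (0 : ℝ))) (Set.Iic (0 : ℝ)))
        cM (Set.Iic (0 : ℝ)) 0 ∧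
      cP - cM = -3 * (aP - aM) / (r₀ * (F₁ 0) ^ 4) ∧ cP - cM ≠ 0) ∧
    ∀ U ∈ nhds (0 : ℝ), ¬ ContDiffOn ℝ 3 G U := by
  have hsd : ∀ x, HasStrictDerivAt s (F₁ x) x := fun x => by
    rw [funext hs]
    exact intervalIntegral.integral_hasStrictDerivAt_right (hcont.intervalIntegrable _ _)
      (hcont.stronglyMeasurableAtFilter _ _) hcont.continuousAt
  have hs0 : s 0 = 0 := by simp [hs]
  have hρ0 : ρ 0 = 0 := by simpa [hs0] using hρ 0
  have hmono : StrictMono s := strictMono_of_deriv_pos fun x => by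
    rw [(hsd x).hasDerivAt.deriv]
    exact hpos x
  have hmap : map s (𝓝 0) = 𝓝 0 := by
    simpa [hs0] using (hsd 0).map_nhds_eq (hpos 0).ne'
  have hev : ∀ {p : ℝ → Prop}, (∀ x, p (s x)) → ∀ᶠ y in 𝓝 0, p y := fun {p} h => by
    rw [← hmap]
    exact eventually_map.2 (.of_forall h)
  have hρd : ∀ᶠ y in 𝓝 0, HasDerivAt ρ (F₁ (ρ y))⁻¹ y := hev fun x => by
    rw [hρ]
    exact ((hsd x).to_local_left_inverse (hpos x).ne' (.of_forall hρ)).hasDerivAt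
  have hρP : ∀ᶠ y in 𝓝[Ici 0] 0, ρ y ∈ Ici (0 : ℝ) := by
    refine eventually_nhdsWithin_iff.2 (hev fun x hx => ?_)
    rw [hρ]
    exact hmono.le_iff_le.1 (hs0.symm ▸ hx)
  have hρM : ∀ᶠ y in 𝓝[Iic 0] 0, ρ y ∈ Iic (0 : ℝ) := by
    refine eventually_nhdsWithin_iff.2 (hev fun x hx => ?_)
    rw [hρ]
    exact hmono.le_iff_le.1 (hs0.symm ▸ hx)
  have hGeq : G = fun y => Real.sqrt (ρ y ^ 2 + r₀ ^ 2) := by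
    rw [hG]
    exact funext fun y => hF₂ (ρ y)
  have hcP := hasDerivWithinAt_areal_radius_third (uniqueDiffOn_Ici 0) self_mem_Ici hP hpos hρ0
    (hρd.filter_mono nhdsWithin_le_nhds) hρP hr₀
  have hcM := hasDerivWithinAt_areal_radius_third (uniqueDiffOn_Iic 0) self_mem_Iic hM hpos hρ0
    (hρd.filter_mono nhdsWithin_le_nhds) hρM hr₀
  rw [← hGeq, ← haP] at hcP
  rw [← hGeq, ← haM] at hcM
  have hjump : -3 * aP / (r₀ * F₁ 0 ^ 4) - -3 * aM / (r₀ * F₁ 0 ^ 4)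
      = -3 * (aP - aM) / (r₀ * F₁ 0 ^ 4) := by ring
  have hjump_ne : -3 * aP / (r₀ * F₁ 0 ^ 4) - -3 * aM / (r₀ * F₁ 0 ^ 4) ≠ 0 := by
    rw [hjump]
    exact div_ne_zero (mul_ne_zero (by norm_num) (sub_ne_zero.2 hne))
      (mul_pos hr₀ (pow_pos (hpos 0) 4)).ne'
  refine ⟨⟨_, _, hcP, hcM, hjump, hjump_ne⟩, fun U hU hC => hjump_ne ?_⟩
  have hCA := hC.contDiffAt hU
  have eP := (uniqueDiffOn_Ici (0 : ℝ) 0 self_mem_Ici).eq_deriv _ hcP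
    (hCA.hasDerivWithinAt_derivWithin_derivWithin (uniqueDiffOn_Ici 0) self_mem_Ici)
  have eM := (uniqueDiffOn_Iic (0 : ℝ) 0 self_mem_Iic).eq_deriv _ hcM
    (hCA.hasDerivWithinAt_derivWithin_derivWithin (uniqueDiffOn_Iic 0) self_mem_Iic)
  rw [eP, eM, sub_self]
end

section
/- For z ∈ ℂ, κ ∈ {−1,1}, and w, t, θ, φ ∈ ℝ, define the Dirac spinor Ψ₁(z)(t,θ,φ) := e^{i(φ/2 − tw)} · (cos(θ/2)·z, iκ·sin(θ/2)·z̄, −i·cos(θ/2)·z̄, −κ·sin(θ/2)·z) ∈ ℂ⁴. Let γ⁰ = [[0,0,1,0],[0,0,0,1],[1,0,0,0],[0,1,0,0]], let 𝒫 = η·γ⁰ with η ∈ {1,−1,i,−i}, and let ℛ = ε·diag(i,−i,i,−i) with ε ∈ {−1,1}. If for some η ∈ {1,−1,i,−i}, ε ∈ {−1,1}, κ ∈ {−1,1}, w, t, φ ∈ ℝ, and some θ ∈ ℝ with cos(θ/2) ≠ 0 and sin(θ/2) ≠ 0, the matching condition Ψ₁(z)(t,θ,φ) = 𝒫⁻¹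 ℛ⁻¹ Ψ₁(z)(t,θ,φ) holds, then z = 0. -/
open Complex Matrix

theorem BSKR_psi1_matching_forces_z_zero
    (z : ℂ) (κ : ℝ) (hκ : κ = 1 ∨ κ = -1)
    (w t θ φ : ℝ)
    (Ψ : Fin 4 → ℂ)
    (hΨ : Ψ = Complex.exp (I * ((φ / 2 : ℝ) - t * w)) •
      ![(Real.cos (θ / 2) : ℂ) * z,
        I * (κ : ℂ) * (Real.sin (θ / 2) : ℂ) * (starRingEnd ℂ) z,
        -I * (Real.cos (θ / 2) : ℂ) * (starRingEnd ℂ) z,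
        -(κ : ℂ) * (Real.sin (θ / 2) : ℂ) * z])
    (γ0 : Matrix (Fin 4) (Fin 4) ℂ)
    (hγ0 : γ0 = !![0,0,1,0; 0,0,0,1; 1,0,0,0; 0,1,0,0])
    (η : ℂ) (hη : η = 1 ∨ η = -1 ∨ η = I ∨ η = -I)
    (ε : ℂ) (hε : ε = 1 ∨ ε = -1)
    (P R : Matrix (Fin 4) (Fin 4) ℂ)
    (hP : P = η • γ0)
    (hR : R = ε • Matrix.diagonal ![I, -I, I, -I])
    (hcos : Real.cos (θ / 2) ≠ 0) (hsin : Real.sin (θ / 2) ≠ 0)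
    (hmatch : Ψ = (P⁻¹ * R⁻¹).mulVec Ψ) :
    z = 0 := by
  have hη0 : η ≠ 0 := by rcases hη with h | h | h | h <;> simp [h]
  have hε0 : ε ≠ 0 := by rcases hε with h | h <;> simp [h]
  have hκ0 : (κ : ℂ) ≠ 0 := by rcases hκ with h | h <;> simp [h]
  have hc : (Real.cos (θ / 2) : ℂ) ≠ 0 := by exact_mod_cast hcos
  have hs : (Real.sin (θ / 2) : ℂ) ≠ 0 := by exact_mod_cast hsin
  have hPinv : P⁻¹ = η⁻¹ • γ0 := by
    apply Matrix.inv_eq_right_inv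
    subst hP hγ0
    ext i j
    fin_cases i <;> fin_cases j <;> simp [Matrix.mul_apply, Fin.sum_univ_four, hη0]
  have hRinv : R⁻¹ = ε⁻¹ • Matrix.diagonal ![-I, I, -I, I] := by
    apply Matrix.inv_eq_right_inv
    subst hR
    ext i j
    fin_cases i <;> fin_cases j <;> simp [hε0]
  have hE := Complex.exp_ne_zero (I * ((φ / 2 : ℝ) - t * w))
  generalize Complex.exp (I * ((φ / 2 : ℝ) - t * w)) = E at hΨ hE
  generalize (Real.cos (θ / 2) : ℂ) = c at hΨ hc
  generalize (Real.sin (θ / 2) : ℂ) = s at hΨ hs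
  generalize (κ : ℂ) = k at hΨ hκ0
  rw [hPinv, hRinv, hγ0, hΨ] at hmatch
  have h₁ := congrFun hmatch 1
  have h₂ := congrFun hmatch 2
  simp [Matrix.mulVec, dotProduct, Matrix.mul_apply, Fin.sum_univ_four] at h₁ h₂
  field_simp at h₁ h₂
  exact self_eq_neg.mp (h₂.symm.trans h₁)
end

section
/- For z ∈ ℂ, κ ∈ {−1,1}, and w, t, θ, φ ∈ ℝ, define the Dirac spinor Ψ₂(z)(t,θ,φ) := e^{i(−φ/2 − tw)} · (i·sin(θ/2)·z, κ·cos(θ/2)·z̄, sin(θ/2)·z̄, iκ·cos(θ/2)·z) ∈ ℂ⁴. Let γ⁰ = [[0,0,1,0],[0,0,0,1],[1,0,0,0],[0,1,0,0]], let 𝒫 = η·γ⁰ with η ∈ {1,−1,i,−i}, and let ℛ = ε·diag(i,−i,i,−i) with ε ∈ {−1,1}. If for some η ∈ {1,−1,i,−i}, ε ∈ {−1,1}, κ ∈ {−1,1}, w, t, φ ∈ ℝ, and some θ ∈ ℝ with cos(θ/2) ≠ 0 and sin(θ/2) ≠ 0, the matching condition Ψ₂(z)(t,θ,φ) = 𝒫⁻¹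 ℛ⁻¹ Ψ₂(z)(t,θ,φ) holds, then z = 0. -/
open Complex Matrix

theorem BSKR_psi2_matching_forces_z_zero
    (z : ℂ) (κ : ℝ) (hκ : κ = 1 ∨ κ = -1)
    (w t θ φ : ℝ)
    (Ψ : Fin 4 → ℂ)
    (hΨ : Ψ = Complex.exp (I * (-(φ / 2 : ℝ) - t * w)) •
      ![I * (Real.sin (θ / 2) : ℂ) * z,
        (κ : ℂ) * (Real.cos (θ / 2) : ℂ) * (starRingEnd ℂ) z,
        (Real.sin (θ / 2) : ℂ) * (starRingEnd ℂ) z,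
        I * (κ : ℂ) * (Real.cos (θ / 2) : ℂ) * z])
    (γ0 : Matrix (Fin 4) (Fin 4) ℂ)
    (hγ0 : γ0 = !![0,0,1,0; 0,0,0,1; 1,0,0,0; 0,1,0,0])
    (η : ℂ) (hη : η = 1 ∨ η = -1 ∨ η = I ∨ η = -I)
    (ε : ℂ) (hε : ε = 1 ∨ ε = -1)
    (P R : Matrix (Fin 4) (Fin 4) ℂ)
    (hP : P = η • γ0)
    (hR : R = ε • Matrix.diagonal ![I, -I, I, -I])
    (hcos : Real.cos (θ / 2) ≠ 0) (hsin : Real.sin (θ / 2) ≠ 0)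
    (hmatch : Ψ = (P⁻¹ * R⁻¹).mulVec Ψ) :
    z = 0 := by
  have hη0 : η ≠ 0 := by rcases hη with rfl | rfl | rfl | rfl <;> simp
  have hε0 : ε ≠ 0 := by rcases hε with rfl | rfl <;> simp
  have hκ0 : (κ : ℂ) ≠ 0 := by rcases hκ with rfl | rfl <;> simp
  have hPdet : IsUnit P.det := by
    refine (isUnit_iff_isUnit_det P).1 (.of_mul_eq_one (η⁻¹ • γ0) ?_)
    rw [hP, smul_mul_smul_comm, mul_inv_cancel₀ hη0, one_smul, hγ0]
    ext i j
    fin_cases i <;> fin_cases j <;> simp [Matrix.mul_apply, Fin.sum_univ_four]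
  have hRdet : IsUnit R.det := by
    rw [hR, det_smul, det_diagonal, isUnit_iff_ne_zero]
    simp [Fin.prod_univ_four, hε0]
  have hRP : (R * P) *ᵥ Ψ = Ψ := by
    conv_lhs => rw [hmatch]
    rw [mulVec_mulVec, ← Matrix.mul_assoc, mul_nonsing_inv_cancel_right _ _ hPdet,
      mul_nonsing_inv _ hRdet, one_mulVec]
  have hE := Complex.exp_ne_zero (I * (-(φ / 2 : ℝ) - t * w))
  set E := Complex.exp (I * (-(φ / 2 : ℝ) - t * w))
  set s : ℂ := (Real.sin (θ / 2) : ℂ)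
  set c : ℂ := (Real.cos (θ / 2) : ℂ)
  have hs0 : s ≠ 0 := ofReal_ne_zero.2 hsin
  have hc0 : c ≠ 0 := ofReal_ne_zero.2 hcos
  clear_value s c E
  subst hP hR hγ0 hΨ
  have h1 := congrFun hRP 1
  have h2 := congrFun hRP 2
  simp [Matrix.mulVec, dotProduct, Fin.sum_univ_four, Matrix.mul_apply,
    Matrix.diagonal_apply] at h1 h2
  have h3 : starRingEnd ℂ z = ε * η * z := by
    apply mul_left_cancel₀ (mul_ne_zero hE (mul_ne_zero hκ0 hc0))
    linear_combination -h1 - E * κ * c * ε * η * z * I_sq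
  have h4 : starRingEnd ℂ z = -(ε * η * z) := by
    apply mul_left_cancel₀ (mul_ne_zero hE hs0)
    linear_combination -h2 + E * s * ε * η * z * I_sq
  have h5 : (ε * η) * z = 0 := by linear_combination (h4 - h3) / 2
  exact (mul_eq_zero.1 h5).resolve_left (mul_ne_zero hε0 hη0)
end

section
/- For z ∈ ℂ, κ ∈ {−1,1}, and w, t, θ, φ ∈ ℝ, define the Dirac spinor Ψ₁(z)(t,θ,φ) := e^{i(φ/2 − tw)} · (cos(θ/2)·z, iκ·sin(θ/2)·z̄, −i·cos(θ/2)·z̄, −κ·sin(θ/2)·z) ∈ ℂ⁴. Let γ⁰ = [[0,0,1,0],[0,0,0,1],[1,0,0,0],[0,1,0,0]], let 𝒫 = η·γ⁰ with η ∈ {1,−1,i,−i}, let ℛ = ε·diag(i,−i,i,−i) with ε ∈ {−1,1}, and for ρ ∈ ℝ define time reversal 𝒯 acting on a t-dependent spinor (α(t), β(t), γ(t), δ(t)) by (𝒯Ψ)(t) := e^{iρ}·(β̄(−t), −ᾱ(−t), δ̄(−t), −γ̄(−t)). If for some η ∈ {1,−1,i,−i}, ε ∈ {−1,1}, κ ∈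 {−1,1}, ρ, w ∈ ℝ, the matching condition Ψ₁(z)(t,θ,φ) = 𝒫⁻¹ ℛ⁻¹ (𝒯(Ψ₁(z)(·,θ,φ)))(t) holds for all t, θ, φ ∈ ℝ, then z = 0. -/
open Complex Matrix

theorem BSKR_psi1_time_reversal_matching_forces_z_zero
    (z : ℂ) (κ : ℝ) (hκ : κ = 1 ∨ κ = -1)
    (w : ℝ)
    (Ψ : ℝ → ℝ → ℝ → Fin 4 → ℂ)
    (hΨ : ∀ t θ φ : ℝ, Ψ t θ φ = Complex.exp (I * ((φ / 2 : ℝ) - t * w)) •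
      ![(Real.cos (θ / 2) : ℂ) * z,
        I * (κ : ℂ) * (Real.sin (θ / 2) : ℂ) * (starRingEnd ℂ) z,
        -I * (Real.cos (θ / 2) : ℂ) * (starRingEnd ℂ) z,
        -(κ : ℂ) * (Real.sin (θ / 2) : ℂ) * z])
    (γ0 : Matrix (Fin 4) (Fin 4) ℂ)
    (hγ0 : γ0 = !![0,0,1,0; 0,0,0,1; 1,0,0,0; 0,1,0,0])
    (η : ℂ) (hη : η = 1 ∨ η = -1 ∨ η = I ∨ η = -I)
    (ε : ℂ) (hε : ε = 1 ∨ ε = -1)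
    (P R : Matrix (Fin 4) (Fin 4) ℂ)
    (hP : P = η • γ0)
    (hR : R = ε • Matrix.diagonal ![I, -I, I, -I])
    (ρ : ℝ) (TΨ : ℝ → ℝ → ℝ → Fin 4 → ℂ)
    (hT : ∀ t θ φ : ℝ, TΨ t θ φ = Complex.exp (I * ρ) •
      ![(starRingEnd ℂ) (Ψ (-t) θ φ 1), -(starRingEnd ℂ) (Ψ (-t) θ φ 0),
        (starRingEnd ℂ) (Ψ (-t) θ φ 3), -(starRingEnd ℂ) (Ψ (-t) θ φ 2)])
    (hmatch : ∀ t θ φ : ℝ, Ψ t θ φ = (P⁻¹ * R⁻¹).mulVec (TΨ t θ φ)) :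
    z = 0 := by
  have hη0 : η ≠ 0 := by rcases hη with rfl | rfl | rfl | rfl <;> simp
  have hε0 : ε ≠ 0 := by rcases hε with rfl | rfl <;> simp
  have hPinv : P⁻¹ = η⁻¹ • γ0 := by
    refine Matrix.inv_eq_right_inv ?_
    have hγ : γ0 * γ0 = 1 := by
      subst hγ0
      ext i j
      fin_cases i <;> fin_cases j <;> simp [Matrix.mul_apply, Fin.sum_univ_four]
    rw [hP, Matrix.smul_mul, Matrix.mul_smul, smul_smul, hγ, mul_inv_cancel₀ hη0, one_smul]
  have hRinv : R⁻¹ = ε⁻¹ • Matrix.diagonal ![-I, I, -I, I] := by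
    refine Matrix.inv_eq_right_inv ?_
    have hD : Matrix.diagonal ![I, -I, I, -I] * Matrix.diagonal ![-I, I, -I, I] = 1 := by
      rw [Matrix.diagonal_mul_diagonal, ← Matrix.diagonal_one]
      congr 1
      ext i
      fin_cases i <;> simp
    rw [hR, Matrix.smul_mul, Matrix.mul_smul, smul_smul, hD, mul_inv_cancel₀ hε0, one_smul]
  -- At `θ = 0` the lower spin components vanish, and the matching condition equates
  -- the component `z` with a multiple of one of them.
  have hΨ0 : Ψ 0 0 0 0 = z := by simp [hΨ]
  have hΨ3 : Ψ 0 0 0 3 = 0 := by simp [hΨ]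
  have hT2 : TΨ 0 0 0 2 = 0 := by simp [hT, hΨ3]
  have h := congrFun (hmatch 0 0 0) 0
  rw [hΨ0, hPinv, hRinv, hγ0, ← Matrix.mulVec_mulVec] at h
  simpa [Matrix.mulVec, dotProduct, Fin.sum_univ_four, Matrix.diagonal_apply, hT2] using h
end

section
/- For z ∈ ℂ, κ ∈ {−1,1}, and w, t, θ, φ ∈ ℝ, define the Dirac spinors Ψ₁(z)(t,θ,φ) := e^{i(φ/2 − tw)} · (cos(θ/2)·z, iκ·sin(θ/2)·z̄, −i·cos(θ/2)·z̄, −κ·sin(θ/2)·z) ∈ ℂ⁴ and Ψ₂(z)(t,θ,φ) := e^{i(−φ/2 − tw)} · (i·sin(θ/2)·z, κ·cos(θ/2)·z̄, sin(θ/2)·z̄, iκ·cos(θ/2)·z) ∈ ℂ⁴. Let γ⁰ = [[0,0,1,0],[0,0,0,1],[1,0,0,0],[0,1,0,0]], let 𝒫 = η·γ⁰ with η ∈ {1,−1,i,−i}, let ℛ = ε·diag(i,−i,i,−i) with ε ∈ {−1,1}, and for ρ ∈ ℝ define time reversal 𝒯 acting on a t-dependent spinor (α(t), β(t), γ(t),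 δ(t)) by (𝒯Ψ)(t) := e^{iρ}·(β̄(−t), −ᾱ(−t), δ̄(−t), −γ̄(−t)). If for some η ∈ {1,−1,i,−i}, ε ∈ {−1,1}, κ ∈ {−1,1}, ρ, w ∈ ℝ, the cross-matching condition Ψ₁(z)(t,θ,φ) = 𝒫⁻¹ ℛ⁻¹ (𝒯(Ψ₂(z)(·,θ,φ)))(t) holds for all t, θ, φ ∈ ℝ, then z = 0. -/
open Complex Matrix

theorem BSKR_psi1_psi2_cross_time_reversal_matching_forces_z_zero
    (z : ℂ) (κ : ℝ) (hκ : κ = 1 ∨ κ = -1)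
    (w : ℝ)
    (Ψ₁ Ψ₂ : ℝ → ℝ → ℝ → Fin 4 → ℂ)
    (hΨ₁ : ∀ t θ φ : ℝ, Ψ₁ t θ φ = Complex.exp (I * ((φ / 2 : ℝ) - t * w)) •
      ![(Real.cos (θ / 2) : ℂ) * z,
        I * (κ : ℂ) * (Real.sin (θ / 2) : ℂ) * (starRingEnd ℂ) z,
        -I * (Real.cos (θ / 2) : ℂ) * (starRingEnd ℂ) z,
        -(κ : ℂ) * (Real.sin (θ / 2) : ℂ) * z])
    (hΨ₂ : ∀ t θ φ : ℝ, Ψ₂ t θ φ = Complex.exp (I * (-(φ / 2 : ℝ) - t * w)) •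
      ![I * (Real.sin (θ / 2) : ℂ) * z,
        (κ : ℂ) * (Real.cos (θ / 2) : ℂ) * (starRingEnd ℂ) z,
        (Real.sin (θ / 2) : ℂ) * (starRingEnd ℂ) z,
        I * (κ : ℂ) * (Real.cos (θ / 2) : ℂ) * z])
    (γ0 : Matrix (Fin 4) (Fin 4) ℂ)
    (hγ0 : γ0 = !![0,0,1,0; 0,0,0,1; 1,0,0,0; 0,1,0,0])
    (η : ℂ) (hη : η = 1 ∨ η = -1 ∨ η = I ∨ η = -I)
    (ε : ℂ) (hε : ε = 1 ∨ ε = -1)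
    (P R : Matrix (Fin 4) (Fin 4) ℂ)
    (hP : P = η • γ0)
    (hR : R = ε • Matrix.diagonal ![I, -I, I, -I])
    (ρ : ℝ) (TΨ₂ : ℝ → ℝ → ℝ → Fin 4 → ℂ)
    (hT : ∀ t θ φ : ℝ, TΨ₂ t θ φ = Complex.exp (I * ρ) •
      ![(starRingEnd ℂ) (Ψ₂ (-t) θ φ 1), -(starRingEnd ℂ) (Ψ₂ (-t) θ φ 0),
        (starRingEnd ℂ) (Ψ₂ (-t) θ φ 3), -(starRingEnd ℂ) (Ψ₂ (-t) θ φ 2)])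
    (hmatch : ∀ t θ φ : ℝ, Ψ₁ t θ φ = (P⁻¹ * R⁻¹).mulVec (TΨ₂ t θ φ)) :
    z = 0 := by
  have hη0 : η ≠ 0 := by
    rcases hη with rfl | rfl | rfl | rfl <;> simp
  have hε0 : ε ≠ 0 := by
    rcases hε with rfl | rfl <;> simp
  have hκ2 : (κ : ℂ) * κ = 1 := by
    rcases hκ with rfl | rfl <;> simp
  have hPinv : P⁻¹ = η⁻¹ • γ0 := by
    apply Matrix.inv_eq_right_inv
    rw [hP, Matrix.smul_mul, Matrix.mul_smul, smul_smul, mul_inv_cancel₀ hη0, one_smul, hγ0]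
    ext i j
    fin_cases i <;> fin_cases j <;> simp [Matrix.mul_apply, Fin.sum_univ_four]
  have hRinv : R⁻¹ = ε⁻¹ • Matrix.diagonal ![-I, I, -I, I] := by
    apply Matrix.inv_eq_right_inv
    rw [hR, Matrix.smul_mul, Matrix.mul_smul, smul_smul, mul_inv_cancel₀ hε0, one_smul,
      Matrix.diagonal_mul_diagonal, ← Matrix.diagonal_one]
    congr 1
    ext i
    fin_cases i <;> simp
  have hPR : P⁻¹ * R⁻¹ =
      (η⁻¹ * ε⁻¹) • !![0, 0, -I, 0; 0, 0, 0, I; -I, 0, 0, 0; 0, I, 0, 0] := by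
    rw [hPinv, hRinv, Matrix.smul_mul, Matrix.mul_smul, smul_smul, hγ0]
    congr 1
    ext i j
    fin_cases i <;> fin_cases j <;> simp [Matrix.mul_diagonal]
  have h0 := congrFun (hmatch 0 0 0) 0
  have h3 := congrFun (hmatch 0 Real.pi 0) 3
  rw [hT, hPR, hΨ₁, hΨ₂] at h0 h3
  simp [Matrix.mulVec, dotProduct, Fin.sum_univ_four] at h0 h3
  have hκz : (κ : ℂ) * z = 0 := by
    linear_combination (κ / 2 : ℂ) * h0 - h3 / 2
      + (I ^ 2 * η⁻¹ * ε⁻¹ * cexp (I * ρ) * (starRingEnd ℂ) z / 2) * hκ2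
  linear_combination (κ : ℂ) * hκz - z * hκ2
end
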